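/- arXiv:2506.02259 — 3 statements merged into one kernel-verified Lean document; each statement's English description precedes it below -/
import Mathlib

section
/- Let a < b be real numbers and let X and Y be integrable real-valued random variables with a ≤ X ≤ b and a ≤ Y ≤ b almost surely and E[X] ≥ E[Y]. Set λ_X = (E[X] − a)/(b − a) and λ_Y = (E[Y] − a)/(b − a). Then for every K ≥ 1, the distribution of (1/K)·Bin(K, λ_X) first-order stochastically dominates the distribution of (1/K)·Bin(K, λ_Y). (SD-truthfulness of the partition rounding reduction: if the individual score of a truthful mechanism on each of K disjoint question subsets has mean at least as large under truth-telling as under any deviation, the average of the K directly rounded individual scores is SD-truthful.) -/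
open MeasureTheory

/-- The probability mass function of the binomial distribution `Bin(n, p)`. -/
noncomputable def binomPMF (n : ℕ) (p : ℝ) : ℕ → ℝ :=
  fun k => (n.choose k : ℝ) * p ^ k * (1 - p) ^ (n - k)

theorem binomPMF_nonneg (n : ℕ) {p : ℝ} (hp₀ : 0 ≤ p) (hp₁ : p ≤ 1) (k : ℕ) :
    0 ≤ binomPMF n p k := by
  have : 0 ≤ 1 - p := sub_nonneg.2 hp₁
  unfold binomPMF
  positivity

theorem binomPMF_eq_zero_of_lt {n k : ℕ} (h : n < k) (p : ℝ) : binomPMF n p k = 0 := by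
  simp [binomPMF, Nat.choose_eq_zero_of_lt h]

theorem binomPMF_succ_zero (n : ℕ) (p : ℝ) :
    binomPMF (n + 1) p 0 = (1 - p) * binomPMF n p 0 := by
  simp [binomPMF, pow_succ']

/-- Pascal's rule for the binomial mass function. -/
theorem binomPMF_succ_succ (n : ℕ) (p : ℝ) (k : ℕ) :
    binomPMF (n + 1) p (k + 1) = p * binomPMF n p k + (1 - p) * binomPMF n p (k + 1) := by
  rcases lt_or_ge k n with h | h
  · obtain ⟨m, rfl⟩ := Nat.exists_eq_add_of_lt h
    have h₁ : k + m + 1 + 1 - (k + 1) = m + 1 := by omega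
    have h₂ : k + m + 1 - k = m + 1 := by omega
    have h₃ : k + m + 1 - (k + 1) = m := by omega
    simp only [binomPMF, Nat.choose_succ_succ (k + m + 1) k, h₁, h₂, h₃]
    push_cast
    ring
  · rw [binomPMF_eq_zero_of_lt (Nat.lt_succ_of_le h)]
    rcases h.eq_or_lt with rfl | h
    · simp [binomPMF, pow_succ']
    · rw [binomPMF_eq_zero_of_lt h, binomPMF_eq_zero_of_lt (Nat.succ_lt_succ h)]
      ring

/-- Conditioning the expectation of `g` under `Bin(n + 1, p)` on one of the trials. -/
theorem sum_binomPMF_succ_mul (n : ℕ) (p : ℝ) (g : ℕ → ℝ) :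
    ∑ k ∈ Finset.range (n + 2), binomPMF (n + 1) p k * g k =
      p * ∑ k ∈ Finset.range (n + 1), binomPMF n p k * g (k + 1) +
        (1 - p) * ∑ k ∈ Finset.range (n + 1), binomPMF n p k * g k := by
  have h : ∑ k ∈ Finset.range (n + 1), binomPMF n p k * g k =
      ∑ k ∈ Finset.range (n + 2), binomPMF n p k * g k := by
    rw [Finset.sum_range_succ _ (n + 1), binomPMF_eq_zero_of_lt n.lt_succ_self]
    simp
  rw [h, Finset.sum_range_succ', Finset.sum_range_succ' _ (n + 1), binomPMF_succ_zero, mul_add,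
    Finset.mul_sum, Finset.mul_sum, ← add_assoc, ← Finset.sum_add_distrib]
  congr 1
  · refine Finset.sum_congr rfl fun k _ => ?_
    rw [binomPMF_succ_succ]
    ring
  · ring

/-- The expectation of a monotone function under `Bin(n, p)` is monotone in `p`. -/
theorem sum_binomPMF_mul_le_sum_binomPMF_mul {p q : ℝ} (hq : 0 ≤ q) (hqp : q ≤ p) (hp : p ≤ 1)
    (n : ℕ) {g : ℕ → ℝ} (hg : Monotone g) :
    ∑ k ∈ Finset.range (n + 1), binomPMF n q k * g k ≤
      ∑ k ∈ Finset.range (n + 1), binomPMF n p k * g k := by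
  induction n generalizing g with
  | zero => simp [binomPMF]
  | succ n ih =>
    rw [sum_binomPMF_succ_mul, sum_binomPMF_succ_mul]
    have h₁ := ih (g := fun k => g (k + 1)) fun _ _ hij => hg (Nat.add_le_add_right hij 1)
    have h₂ := ih hg
    have h₃ : ∑ k ∈ Finset.range (n + 1), binomPMF n p k * g k ≤
        ∑ k ∈ Finset.range (n + 1), binomPMF n p k * g (k + 1) :=
      Finset.sum_le_sum fun k _ =>
        mul_le_mul_of_nonneg_left (hg (Nat.le_succ k)) (binomPMF_nonneg n (hq.trans hqp) hp k)
    linarith [mul_le_mul_of_nonneg_left h₁ hq,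
      mul_le_mul_of_nonneg_left h₂ (sub_nonneg.2 (hqp.trans hp)),
      mul_nonneg (sub_nonneg.2 hqp) (sub_nonneg.2 h₃)]

theorem tsum_ite_binomPMF_eq_sum (n : ℕ) (p t : ℝ) :
    ∑' k : ℕ, (if t ≤ (k : ℝ) / n then binomPMF n p k else 0) =
      ∑ k ∈ Finset.range (n + 1), binomPMF n p k * (if t ≤ (k : ℝ) / n then 1 else 0) := by
  simp only [mul_ite, mul_one, mul_zero]
  refine tsum_eq_sum fun k hk => ?_
  have hnk : n < k := by
    rw [Finset.mem_range] at hk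
    omega
  rw [binomPMF_eq_zero_of_lt hnk, ite_self]

/-- SD-truthfulness of the partition rounding reduction: if `X, Y ∈ [a, b]`
are integrable with `E[X] ≥ E[Y]`, then for every `K ≥ 1` the distribution of
`(1/K)·Bin(K, λ_X)` first-order stochastically dominates that of `(1/K)·Bin(K, λ_Y)`,
where `λ_X = (E[X] − a)/(b − a)` and `λ_Y = (E[Y] − a)/(b − a)`.
The FOSD is stated directly: for every real `t`,
`Pr((1/K)·Bin(K, λ_Y) ≥ t) ≤ Pr((1/K)·Bin(K, λ_X) ≥ t)`. -/
theorem partition_rounding_sd_truthful {Ω : Type*} [MeasurableSpace Ω]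
    (μ : Measure Ω) [IsProbabilityMeasure μ]
    (a b : ℝ) (hab : a < b) (X Y : Ω → ℝ)
    (hXint : Integrable X μ) (hYint : Integrable Y μ)
    (hXa : ∀ᵐ ω ∂μ, a ≤ X ω) (hXb : ∀ᵐ ω ∂μ, X ω ≤ b)
    (hYa : ∀ᵐ ω ∂μ, a ≤ Y ω) (hYb : ∀ᵐ ω ∂μ, Y ω ≤ b)
    (hE : ∫ ω, Y ω ∂μ ≤ ∫ ω, X ω ∂μ)
    (K : ℕ) (hK : 1 ≤ K) :
    ∀ t : ℝ,
      ∑' k : ℕ, (if t ≤ (k : ℝ) / K then binomPMF K ((∫ ω, Y ω ∂μ - a) / (b - a)) k else 0)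
        ≤ ∑' k : ℕ, (if t ≤ (k : ℝ) / K then binomPMF K ((∫ ω, X ω ∂μ - a) / (b - a)) k else 0) := by
  intro t
  have hba : 0 < b - a := sub_pos.2 hab
  have hY : a ≤ ∫ ω, Y ω ∂μ := by
    simpa using integral_mono_ae (integrable_const a) hYint hYa
  have hX : ∫ ω, X ω ∂μ ≤ b := by
    simpa using integral_mono_ae hXint (integrable_const b) hXb
  rw [tsum_ite_binomPMF_eq_sum, tsum_ite_binomPMF_eq_sum]
  refine sum_binomPMF_mul_le_sum_binomPMF_mul (div_nonneg (sub_nonneg.2 hY) hba.le)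
    (by gcongr) ((div_le_one hba).2 (by linarith)) K fun i j hij => ?_
  have hij' : (i : ℝ) / K ≤ (j : ℝ) / K := by gcongr
  split_ifs with h₁ h₂
  · exact le_rfl
  · exact absurd (h₁.trans hij') h₂
  · exact zero_le_one
  · exact le_rfl
end

section
/- Let p : {0,1,2}×{0,1,2} → [0,1] be uniformly self-predicting: for every j and every pair of distinct i, k both different from j, p_{jj} > p_{ij} and p_{ij} = p_{kj}. Let m = (m_0,m_1,m_2) and n = (n_0,n_1,n_2) be nonnegative integer vectors with m_0 + m_1 + m_2 = n_0 + n_1 + n_2, m_0 ≥ n_0, m_1 ≥ n_1 and m_2 ≤ n_2. Define the truthful manipulation matrix ϑ^τ with rows (n_0, 0, m_0 − n_0), (0, n_1, m_1 − n_1), (0, 0, m_2). Then for every matrix ϑ of nonnegative integers with row sums Σ_j ϑ_{ij} = m_i for each i and column sums Σ_i ϑ_{ij} = n_j for each j, the distribution of the sum of independent binomials Σ_{i,j} Bin(ϑ^τ_{ij}, p_{ij}) first-order stochastically dominates the distribution of Σ_{i,j} Bin(ϑ_{ij}, p_{ij}). (Sufficiency direction of the three-signal EA result, case of two over-reported signals.)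 -/
/-- Convolution of two mass functions on `ℕ` (the mass function of the sum of two
independent `ℕ`-valued random variables). -/
noncomputable def nconv (f g : ℕ → ℝ) : ℕ → ℝ :=
  fun k => ∑ i ∈ Finset.range (k + 1), f i * g (k - i)

/-- The mass function of `Σ_{i,j ∈ {0,1,2}} Bin(a i j, p i j)`, a sum of nine
independent binomial random variables. -/
noncomputable def binomSum3 (a : Fin 3 → Fin 3 → ℕ) (p : Fin 3 → Fin 3 → ℝ) : ℕ → ℝ :=
  nconv (binomPMF (a 0 0) (p 0 0)) <|
  nconv (binomPMF (a 0 1) (p 0 1)) <|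
  nconv (binomPMF (a 0 2) (p 0 2)) <|
  nconv (binomPMF (a 1 0) (p 1 0)) <|
  nconv (binomPMF (a 1 1) (p 1 1)) <|
  nconv (binomPMF (a 1 2) (p 1 2)) <|
  nconv (binomPMF (a 2 0) (p 2 0)) <|
  nconv (binomPMF (a 2 1) (p 2 1)) <|
  binomPMF (a 2 2) (p 2 2)

/-- First-order stochastic dominance of `f` over `g`, for mass functions on `ℕ`:
`Pr_f(X ≥ t) ≥ Pr_g(Y ≥ t)` for every real threshold `t`. -/
def FOSD (f g : ℕ → ℝ) : Prop :=
  ∀ t : ℝ, ∑' k : ℕ, (if t ≤ (k : ℝ) then g k else 0) ≤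
    ∑' k : ℕ, (if t ≤ (k : ℝ) then f k else 0)

open Polynomial

/-- The probability generating polynomial of a Bernoulli variable. -/
noncomputable def bernoulliPoly (p : ℝ) : ℝ[X] := C (1 - p) + C p * X

lemma nconv_coeff (P Q : ℝ[X]) :
    nconv (fun k => P.coeff k) (fun k => Q.coeff k) = fun k => (P * Q).coeff k := by
  funext k
  rw [nconv, coeff_mul,
    Finset.Nat.sum_antidiagonal_eq_sum_range_succ (fun i j => P.coeff i * Q.coeff j)]

lemma binomPMF_eq_coeff (n : ℕ) (p : ℝ) :
    binomPMF n p = fun k => (bernoulliPoly p ^ n).coeff k := by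
  funext k
  have h (i : ℕ) : (C p * X) ^ i * C (1 - p) ^ (n - i) * (n.choose i : ℝ[X]) =
      C (p ^ i * (1 - p) ^ (n - i) * n.choose i) * X ^ i := by
    simp only [C_mul, C_pow, map_natCast]
    ring
  rw [binomPMF, bernoulliPoly, add_comm, add_pow]
  simp only [h, finsetSum_coeff, coeff_C_mul, coeff_X_pow]
  by_cases hk : k ∈ Finset.range (n + 1)
  · simp only [mul_ite, mul_one, mul_zero, Finset.sum_ite_eq, if_pos hk]
    ring
  · have hnk : n < k := by simpa [Nat.lt_succ_iff] using hk
    simp only [mul_ite, mul_one, mul_zero, Finset.sum_ite_eq, if_neg hk,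
      Nat.choose_eq_zero_of_lt hnk, Nat.cast_zero, zero_mul]

/-- All coefficients are nonnegative. -/
def CoeffNonneg (P : ℝ[X]) : Prop := ∀ k, 0 ≤ P.coeff k

lemma CoeffNonneg.mul {P Q : ℝ[X]} (hP : CoeffNonneg P) (hQ : CoeffNonneg Q) :
    CoeffNonneg (P * Q) := fun k => by
  rw [coeff_mul]
  exact Finset.sum_nonneg fun _ _ => mul_nonneg (hP _) (hQ _)

lemma CoeffNonneg.add {P Q : ℝ[X]} (hP : CoeffNonneg P) (hQ : CoeffNonneg Q) :
    CoeffNonneg (P + Q) := fun k => by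
  rw [coeff_add]
  exact add_nonneg (hP k) (hQ k)

lemma coeffNonneg_C {a : ℝ} (ha : 0 ≤ a) : CoeffNonneg (C a) := fun k => by
  rw [coeff_C]
  split_ifs <;> simp [ha]

lemma coeffNonneg_X : CoeffNonneg X := fun k => by
  rw [coeff_X]
  split_ifs <;> simp

lemma CoeffNonneg.pow {P : ℝ[X]} (hP : CoeffNonneg P) (n : ℕ) : CoeffNonneg (P ^ n) := by
  induction n with
  | zero => simpa using coeffNonneg_C zero_le_one
  | succ n ih => rw [pow_succ]; exact ih.mul hP

lemma coeffNonneg_bernoulliPoly {p : ℝ} (h0 : 0 ≤ p) (h1 : p ≤ 1) :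
    CoeffNonneg (bernoulliPoly p) :=
  (coeffNonneg_C (sub_nonneg.2 h1)).add ((coeffNonneg_C h0).mul coeffNonneg_X)

/-- `Q` is obtained from `P` by moving nonnegative mass one step up. For generating polynomials
of mass functions this is first-order stochastic dominance of `Q` over `P`. -/
def PolyDominated (P Q : ℝ[X]) : Prop :=
  ∃ R : ℝ[X], CoeffNonneg R ∧ Q = P + (X - 1) * R

lemma PolyDominated.refl (P : ℝ[X]) : PolyDominated P P :=
  ⟨0, fun k => by simp, by simp⟩

lemma PolyDominated.mul {P Q P' Q' : ℝ[X]} (h : PolyDominated P Q) (h' : PolyDominated P' Q')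
    (hQ : CoeffNonneg Q) (hP' : CoeffNonneg P') : PolyDominated (P * P') (Q * Q') := by
  obtain ⟨R, hR, hPQ⟩ := h
  obtain ⟨R', hR', rfl⟩ := h'
  refine ⟨Q * R' + R * P', (hQ.mul hR').add (hR.mul hP'), ?_⟩
  linear_combination P' * hPQ

lemma PolyDominated.pow {P Q : ℝ[X]} (h : PolyDominated P Q) (hP : CoeffNonneg P)
    (hQ : CoeffNonneg Q) (n : ℕ) : PolyDominated (P ^ n) (Q ^ n) := by
  induction n with
  | zero => simpa using PolyDominated.refl 1
  | succ n ih => simpa only [pow_succ] using ih.mul h (hQ.pow n) hP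

lemma polyDominated_bernoulliPoly {p q : ℝ} (h : p ≤ q) :
    PolyDominated (bernoulliPoly p) (bernoulliPoly q) := by
  refine ⟨C (q - p), coeffNonneg_C (sub_nonneg.2 h), ?_⟩
  simp only [bernoulliPoly, C_sub, C_1]
  ring

lemma PolyDominated.pow_mul_pow {P Q : ℝ[X]} (h : PolyDominated P Q) (hP : CoeffNonneg P)
    (hQ : CoeffNonneg Q) {a b x y : ℕ} (hab : a ≤ b) (hsum : a + x = b + y) :
    PolyDominated (Q ^ a * P ^ x) (Q ^ b * P ^ y) := by
  obtain ⟨c, rfl⟩ := Nat.exists_eq_add_of_le hab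
  obtain rfl : x = c + y := by omega
  rw [pow_add, pow_add, mul_assoc]
  exact (PolyDominated.refl _).mul ((h.pow hP hQ c).mul (PolyDominated.refl _) (hQ.pow c)
    (hP.pow y)) (hQ.pow a) ((hP.pow c).mul (hP.pow y))

lemma PolyDominated.fosd {P Q : ℝ[X]} (h : PolyDominated P Q) :
    FOSD (fun k => Q.coeff k) (fun k => P.coeff k) := by
  intro t
  obtain ⟨R, hR, rfl⟩ := h
  have hs (t : ℝ) (S : ℝ[X]) : Summable fun k : ℕ => if t ≤ (k : ℝ) then S.coeff k else 0 :=
    summable_of_ne_finset_zero (s := S.support) fun k hk => by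
      simp [notMem_support_iff.1 hk]
  have hsplit : (fun k : ℕ => if t ≤ (k : ℝ) then (P + (X - 1) * R).coeff k else 0) =
      fun k : ℕ => (if t ≤ (k : ℝ) then P.coeff k else 0) +
        ((if t ≤ (k : ℝ) then (X * R).coeff k else 0) -
          (if t ≤ (k : ℝ) then R.coeff k else 0)) := by
    funext k
    split_ifs <;> simp [sub_mul]
  have hshift : ∑' k : ℕ, (if t ≤ (k : ℝ) then R.coeff k else 0) ≤
      ∑' k : ℕ, (if t ≤ (k : ℝ) then (X * R).coeff k else 0) := by
    rw [(hs t (X * R)).tsum_eq_zero_add]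
    simp only [coeff_X_mul, mul_coeff_zero, coeff_X_zero, zero_mul, ite_self, zero_add]
    refine (hs t R).tsum_le_tsum (fun k => ?_) ?_
    · have := hR k
      split_ifs with h₁ h₂
      · rfl
      · push_cast at h₂; linarith
      · exact this
      · rfl
    · convert hs (t - 1) R using 3
      push_cast
      rw [sub_le_iff_le_add]
  rw [hsplit, (hs t P).tsum_add ((hs t (X * R)).sub (hs t R)), (hs t (X * R)).tsum_sub (hs t R)]
  linarith

lemma binomSum3_eq_coeff (a : Fin 3 → Fin 3 → ℕ) (p : Fin 3 → Fin 3 → ℝ) (q : Fin 3 → ℝ)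
    (hq : ∀ i j, i ≠ j → p i j = q j) :
    binomSum3 a p = fun k =>
      ((bernoulliPoly (p 0 0) ^ a 0 0 * bernoulliPoly (q 0) ^ (a 1 0 + a 2 0)) *
        ((bernoulliPoly (p 1 1) ^ a 1 1 * bernoulliPoly (q 1) ^ (a 0 1 + a 2 1)) *
          (bernoulliPoly (p 2 2) ^ a 2 2 * bernoulliPoly (q 2) ^ (a 0 2 + a 1 2)))).coeff k := by
  simp only [binomSum3, binomPMF_eq_coeff, nconv_coeff]
  rw [hq 0 1 (by decide), hq 0 2 (by decide), hq 1 0 (by decide), hq 1 2 (by decide),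
    hq 2 0 (by decide), hq 2 1 (by decide)]
  funext k
  congr 1
  ring

/-- Sufficiency direction of the three-signal Enforced Agreement result, case of
two over-reported signals: with uniformly self-predicting `p`, `m₀ ≥ n₀`, `m₁ ≥ n₁`,
`m₂ ≤ n₂`, the truthful manipulation matrix `ϑ^τ` (under the minimal enforcement
rule) yields a score distribution that FOSD-dominates the one of every feasible
manipulation matrix `ϑ`. -/
theorem ea_three_signal_two_over
    (p : Fin 3 → Fin 3 → ℝ)
    (hp0 : ∀ i j, 0 ≤ p i j) (hp1 : ∀ i j, p i j ≤ 1)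
    (husp1 : ∀ i j, i ≠ j → p i j < p j j)
    (husp2 : ∀ i j k, i ≠ j → k ≠ j → p i j = p k j)
    (m n : Fin 3 → ℕ)
    (hsum : ∑ i, m i = ∑ j, n j)
    (h0 : n 0 ≤ m 0) (h1 : n 1 ≤ m 1) (h2 : m 2 ≤ n 2)
    (ϑ : Fin 3 → Fin 3 → ℕ)
    (hrow : ∀ i, ∑ j, ϑ i j = m i)
    (hcol : ∀ j, ∑ i, ϑ i j = n j) :
    FOSD
      (binomSum3 ![![n 0, 0, m 0 - n 0], ![0, n 1, m 1 - n 1], ![0, 0, m 2]] p)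
      (binomSum3 ϑ p) := by
  have hdiag : ∀ j, ϑ j j ≤ m j ∧ ϑ j j ≤ n j := fun j =>
    ⟨hrow j ▸ Finset.single_le_sum (f := fun k => ϑ j k) (fun _ _ => Nat.zero_le _)
      (Finset.mem_univ j),
     hcol j ▸ Finset.single_le_sum (f := fun i => ϑ i j) (fun _ _ => Nat.zero_le _)
      (Finset.mem_univ j)⟩
  have hq : ∀ i j, i ≠ j → p i j = p (j + 1) j := fun i j hij =>
    husp2 i j (j + 1) hij (by fin_cases j <;> decide)
  have hD (j) := coeffNonneg_bernoulliPoly (hp0 j j) (hp1 j j)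
  have hQ (j) := coeffNonneg_bernoulliPoly (hp0 (j + 1) j) (hp1 (j + 1) j)
  have hstep (j) {a b x y : ℕ} (hab : a ≤ b) (hxy : a + x = b + y) :=
    (polyDominated_bernoulliPoly
      (husp1 (j + 1) j (by fin_cases j <;> decide)).le).pow_mul_pow (hQ j) (hD j) hab hxy
  have hcol' (j) := hcol j
  simp only [Fin.sum_univ_three] at hsum hcol'
  have c0 := hcol' 0
  have c1 := hcol' 1
  have c2 := hcol' 2
  have hnn (j) (a x : ℕ) := ((hD j).pow a).mul ((hQ j).pow x)
  rw [binomSum3_eq_coeff _ p (fun j => p (j + 1) j) hq,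
    binomSum3_eq_coeff ϑ p (fun j => p (j + 1) j) hq]
  refine PolyDominated.fosd ?_
  refine (hstep 0 (hdiag 0).2 ?_).mul ((hstep 1 (hdiag 1).2 ?_).mul (hstep 2 (hdiag 2).1 ?_)
    (hnn 1 _ _) (hnn 2 _ _)) (hnn 0 _ _) ((hnn 1 _ _).mul (hnn 2 _ _))
  · simp; omega
  · simp; omega
  · simp; omega
end

section
/- Let J be a joint probability mass function on {0,1}×{0,1} with strictly positive marginals M^a and M^b. Define d = Σ_{σ_1,σ_2} max(Δ(σ_1,σ_2), 0) with Δ(σ_1,σ_2) = J(σ_1,σ_2) − M^a(σ_1)M^b(σ_2), and g = Σ_{σ_1,σ_2,σ_3} M^b(σ_2)M^b(σ_3)·max(Γ(σ_1,σ_2,σ_3), 0) with Γ(σ_1,σ_2,σ_3) = J(σ_1,σ_2)/M^b(σ_2) − J(σ_1,σ_3)/M^b(σ_3). Then for every integer K ≥ 1 and every e ∈ (0,1) with e·d < 1, the partition-rounded sensitivity of the Matching Agreement mechanism equals that of the Correlated Agreement mechanism: (g/2)·√K / √((1/2 + e·g/2)·(1/2 − e·g/2)) = d·√K / √((e·d +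 1)·(1 − e·d)). (In the binary-signal setting, δ^{MA}(e) = δ^{CA}(e) under the partition rounding reduction.) -/
/-- Weighting a positive-part difference of quotients by the denominators clears them. -/
lemma mul_mul_max_div_sub_div {x y p q : ℝ} (hp : 0 < p) (hq : 0 < q) :
    p * q * max (x / p - y / q) 0 = max (x * q - y * p) 0 := by
  rw [mul_max_of_nonneg _ _ (by positivity), mul_zero]
  congr 1
  field_simp

/-- For binary signals, the Matching Agreement coefficient equals the Correlated Agreement one. -/
lemma sum_gamma_pos_eq_sum_delta_pos (J : Fin 2 → Fin 2 → ℝ)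
    (hJ1 : ∑ i, ∑ j, J i j = 1) (hMb : ∀ j, 0 < ∑ i, J i j) :
    ∑ σ1, ∑ σ2, ∑ σ3, (∑ i, J i σ2) * (∑ i, J i σ3) *
        max (J σ1 σ2 / (∑ i, J i σ2) - J σ1 σ3 / (∑ i, J i σ3)) 0
      = ∑ σ1, ∑ σ2, max (J σ1 σ2 - (∑ j, J σ1 j) * (∑ i, J i σ2)) 0 := by
  simp only [mul_mul_max_div_sub_div (hMb _) (hMb _)]
  simp only [Fin.sum_univ_two] at hJ1 ⊢
  set D := J 0 0 * J 1 1 - J 0 1 * J 1 0 with hD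
  have h00 : J 0 0 - (J 0 0 + J 0 1) * (J 0 0 + J 1 0) = D := by
    linear_combination (-J 0 0) * hJ1
  have h01 : J 0 1 - (J 0 0 + J 0 1) * (J 0 1 + J 1 1) = -D := by
    linear_combination (-J 0 1) * hJ1
  have h10 : J 1 0 - (J 1 0 + J 1 1) * (J 0 0 + J 1 0) = -D := by
    linear_combination (-J 1 0) * hJ1
  have h11 : J 1 1 - (J 1 0 + J 1 1) * (J 0 1 + J 1 1) = D := by
    linear_combination (-J 1 1) * hJ1
  have g0 : J 0 0 * (J 0 1 + J 1 1) - J 0 1 * (J 0 0 + J 1 0) = D := by ring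
  have g0' : J 0 1 * (J 0 0 + J 1 0) - J 0 0 * (J 0 1 + J 1 1) = -D := by ring
  have g1 : J 1 0 * (J 0 1 + J 1 1) - J 1 1 * (J 0 0 + J 1 0) = -D := by ring
  have g1' : J 1 1 * (J 0 0 + J 1 0) - J 1 0 * (J 0 1 + J 1 1) = D := by ring
  rw [h00, h01, h10, h11, g0, g0', g1, g1']
  simp only [sub_self, max_self]
  ring

/-- In the binary-signal setting, the partition-rounded sensitivity of the
Matching Agreement mechanism equals that of the Correlated Agreement mechanism:
`(g/2)·√K / √((1/2 + e·g/2)(1/2 − e·g/2)) = d·√K / √((e·d + 1)(1 − e·d))`,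
where `d = Σ (Δ)⁺` and `g = Σ M^b M^b (Γ)⁺`. -/
theorem ma_ca_equal_sensitivity
    (J : Fin 2 → Fin 2 → ℝ)
    (hJ0 : ∀ i j, 0 ≤ J i j) (hJ1 : ∑ i, ∑ j, J i j = 1)
    (hMa : ∀ i, 0 < ∑ j, J i j) (hMb : ∀ j, 0 < ∑ i, J i j)
    (K : ℕ) (hK : 1 ≤ K) (e : ℝ) (he0 : 0 < e) (he1 : e < 1) :
    let d : ℝ := ∑ σ1, ∑ σ2, max (J σ1 σ2 - (∑ j, J σ1 j) * (∑ i, J i σ2)) 0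
    let g : ℝ := ∑ σ1, ∑ σ2, ∑ σ3,
      (∑ i, J i σ2) * (∑ i, J i σ3) *
        max (J σ1 σ2 / (∑ i, J i σ2) - J σ1 σ3 / (∑ i, J i σ3)) 0
    e * d < 1 →
      (g / 2) * Real.sqrt K / Real.sqrt ((1 / 2 + e * g / 2) * (1 / 2 - e * g / 2))
        = d * Real.sqrt K / Real.sqrt ((e * d + 1) * (1 - e * d)) := by
  intro d g _
  have hgd : g = d := sum_gamma_pos_eq_sum_delta_pos J hJ1 hMb
  have hsqrt : √((1 / 2 + e * d / 2) * (1 / 2 - e * d / 2))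
      = √((e * d + 1) * (1 - e * d)) / 2 := by
    rw [show (1 / 2 + e * d / 2) * (1 / 2 - e * d / 2)
        = (e * d + 1) * (1 - e * d) / 2 ^ 2 by ring,
      Real.sqrt_div' _ (by positivity), Real.sqrt_sq (by norm_num)]
  rw [hgd, hsqrt, div_mul_eq_mul_div, div_div_div_cancel_right₀ two_ne_zero]
end
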